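/- Let G be a free group of finite rank r > 1 with free generating set S. Then there exist a standard Borel probability space (X, μ), an action of G on X by μ-preserving Borel automorphisms which is ergodic, a generating countable measurable partition α of X with H(α) < ∞ satisfying lim_{n→∞} F_G(X, μ, S, B_n·α) = 0 (in particular f_G(X, μ) is defined and f_G(X, μ) ≠ −∞), and a non-trivial subgroup Γ ≤ G such that the restricted action of Γ on (X, μ) has infinitely many ergodic components; concretely, there is an infinite family of pairwise disjoint Borel subsets of X, each of positive μ-measure and each Γ-invariant (γ·B = B for all γ ∈ Γ). -/

import Mathlib

open MeasureTheory Filter Set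
open scoped ENNReal symmDiff Pointwise

namespace FPaper

/-- The free group of rank `r`; its free generating set `S` is `{FreeGroup.of i | i : Fin r}`. -/
abbrev FG (r : ℕ) := FreeGroup (Fin r)

/-- The reduced `S`-word length of a group element. -/
def wlen {r : ℕ} (g : FG r) : ℕ := g.toWord.length

/-- The ball of radius `n` in `FG r` with respect to the word length. -/
def ball (r n : ℕ) : Set (FG r) := {g | wlen g ≤ n}

instance ballFinite (r n : ℕ) : Finite (ball r n) := by
  have h : ball r n ⊆ FreeGroup.mk '' {l : List (Fin r × Bool) | l.length ≤ n} :=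
    fun g hg => ⟨g.toWord, hg, FreeGroup.mk_toWord⟩
  exact (((List.finite_length_le _ n).image _).subset h).to_subtype

/-- An action of a group `G` on a measurable space `X` by Borel automorphisms. -/
structure BorelAction (G : Type*) [Group G] (X : Type*) [MeasurableSpace X] where
  act : G → X → X
  act_one : ∀ x, act 1 x = x
  act_mul : ∀ g h x, act (g * h) x = act g (act h x)
  measurable_act : ∀ g, Measurable (act g)

namespace BorelAction

variable {G X : Type*} [Group G] [mX : MeasurableSpace X]

/-- The action preserves the measure `μ`. -/
def Preserves (T : BorelAction G X) (μ : Measure X) : Prop :=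
  ∀ g : G, MeasurePreserving (T.act g) μ μ

/-- The translated set `g · B`. -/
def smulSet (T : BorelAction G X) (g : G) (B : Set X) : Set X := T.act g⁻¹ ⁻¹' B

/-- The translated partition `g · α`, where a countable measurable partition is recorded
by a (measurable, countably-valued) function whose fibers are the cells. -/
def tr {I : Type*} (T : BorelAction G X) (g : G) (a : X → I) : X → I :=
  fun x => a (T.act g⁻¹ x)

/-- The join `F · α = ⋁_{f ∈ F} f · α` of the translates of a partition over a set `F ⊆ G`. -/
def joinF {I : Type*} (T : BorelAction G X) (F : Set G) (a : X → I) : X → (F → I) :=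
  fun x f => a (T.act (f : G)⁻¹ x)

/-- The σ-algebra generated by the partitions `f · α`, `f ∈ F`. -/
def partSA {I : Type*} (T : BorelAction G X) (F : Set G) (a : X → I) : MeasurableSpace X :=
  ⨆ f ∈ F, MeasurableSpace.comap (T.tr f a) ⊤

/-- The partition `a` is generating: the smallest `G`-invariant σ-algebra containing `a`
(i.e. the one generated by all translates of `a`) contains every measurable set up to
`ν`-null sets. -/
def Generating {I : Type*} (T : BorelAction G X) (a : X → I) (ν : Measure X) : Prop :=
  ∀ B : Set X, MeasurableSet B →
    ∃ B', MeasurableSet[T.partSA Set.univ a] B' ∧ ν (B ∆ B') = 0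


/-- Ergodicity of the action with respect to `ν`. -/
def IsErgodic (T : BorelAction G X) (ν : Measure X) : Prop :=
  ∀ B : Set X, MeasurableSet B → (∀ g : G, ν (T.smulSet g B ∆ B) = 0) → ν B = 0 ∨ ν B = 1

/-- The action is essentially free with respect to `ν`. -/
def EssentiallyFree (T : BorelAction G X) (ν : Measure X) : Prop :=
  ν {x | ∀ g : G, g ≠ 1 → T.act g x ≠ x} = 1

/-- The stabilizer subgroup of a point. -/
def stab (T : BorelAction G X) (y : X) : Subgroup G where
  carrier := {g | T.act g y = y}
  one_mem' := T.act_one y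
  mul_mem' := by
    intro g h hg hh
    simp only [Set.mem_setOf_eq] at *
    rw [T.act_mul, hh, hg]
  inv_mem' := by
    intro g hg
    simp only [Set.mem_setOf_eq] at *
    conv_lhs => rw [← hg]
    rw [← T.act_mul, inv_mul_cancel, T.act_one]

end BorelAction

/-- `m` is a `G`-invariant sub-σ-algebra. -/
def InvariantSA {G X : Type*} [Group G] (m : MeasurableSpace X) [mX : MeasurableSpace X]
    (T : BorelAction G X) : Prop :=
  m ≤ mX ∧ ∀ (g : G) (B : Set X), MeasurableSet[m] B → MeasurableSet[m] (T.act g ⁻¹' B)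

/-- A measure is purely atomic: the set of atoms has full measure. -/
def PurelyAtomic {X : Type*} [MeasurableSpace X] (ν : Measure X) : Prop :=
  ν {x | 0 < ν {x}} = 1

/-- Shannon entropy of a countable measurable partition (recorded as a countably-valued
function), with values in `[0, ∞]`. -/
noncomputable def Hpart {X I : Type*} [MeasurableSpace X] [Countable I]
    (μ : Measure X) (a : X → I) : ℝ≥0∞ :=
  ∑' i : I, ENNReal.ofReal (Real.negMulLog (μ (a ⁻¹' {i})).toReal)

/-- Conditional Shannon entropy of a countable partition given a sub-σ-algebra `m`:
`H(α/m) = ∫ ∑_{A ∈ α} φ(E[1_A | m](x)) dμ(x)` with `φ(t) = -t log t`. -/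
noncomputable def condEntS {X I : Type*} (m : MeasurableSpace X) [mX : MeasurableSpace X]
    [Countable I] (μ : Measure X) (a : X → I) : ℝ≥0∞ :=
  ∫⁻ x, ∑' i : I,
    ENNReal.ofReal (Real.negMulLog ((μ[(a ⁻¹' {i}).indicator (fun _ => (1:ℝ)) | m]) x)) ∂μ

/-- Conditional Shannon entropy of a partition given another partition:
`H(α/β) = ∑_{B ∈ β} ∑_{A ∈ α} -μ(B) · (μ(A∩B)/μ(B)) · log (μ(A∩B)/μ(B))`
(equivalently `H(α ∨ β) − H(β)`), with values in `[0, ∞]`. -/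
noncomputable def condEntP {X I J : Type*} [MeasurableSpace X] [Countable I] [Countable J]
    (μ : Measure X) (a : X → I) (b : X → J) : ℝ≥0∞ :=
  ∑' q : I × J, μ (b ⁻¹' {q.2}) *
    ENNReal.ofReal (Real.negMulLog
      ((μ (a ⁻¹' {q.1} ∩ b ⁻¹' {q.2})).toReal / (μ (b ⁻¹' {q.2})).toReal))

/-- `F_G(X, μ, S, β) = (1-2r)·H(β) + ∑_{s ∈ S} H(s·β ∨ β)`. -/
noncomputable def FF {r : ℕ} {X I : Type*} [MeasurableSpace X] [Countable I]
    (μ : Measure X) (T : BorelAction (FG r) X) (b : X → I) : ℝ :=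
  (1 - 2 * (r : ℝ)) * (Hpart μ b).toReal
    + ∑ i : Fin r, (Hpart μ (fun x => (T.tr (FreeGroup.of i) b x, b x))).toReal

/-- The sequence `n ↦ F_G(X, μ, S, B_n · α)`. -/
noncomputable def fSeq {r : ℕ} {X : Type*} [MeasurableSpace X]
    (μ : Measure X) (T : BorelAction (FG r) X) (a : X → ℕ) (n : ℕ) : ℝ :=
  FF μ T (T.joinF (ball r n) a)

/-- The f-invariant entropy `f_G(X, μ) = lim_n F_G(X, μ, S, B_n·α)`, the limit (= infimum,
since the sequence is non-increasing) of the sequence `fSeq`, with values in `[-∞, ∞)`. -/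
noncomputable def fInv {r : ℕ} {X : Type*} [MeasurableSpace X]
    (μ : Measure X) (T : BorelAction (FG r) X) (a : X → ℕ) : EReal :=
  ⨅ n : ℕ, ((fSeq μ T a n : ℝ) : EReal)

/-- Relative version `F_G(X, μ/Σ, S, β) = (1-2r)·H(β/Σ) + ∑_{s ∈ S} H(s·β ∨ β / Σ)`. -/
noncomputable def FFrel {r : ℕ} {X I : Type*} (m : MeasurableSpace X) [mX : MeasurableSpace X]
    [Countable I] (μ : Measure X) (T : BorelAction (FG r) X) (b : X → I) : ℝ :=
  (1 - 2 * (r : ℝ)) * (condEntS m μ b).toReal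
    + ∑ i : Fin r, (condEntS m μ (fun x => (T.tr (FreeGroup.of i) b x, b x))).toReal

/-- The sequence `n ↦ F_G(X, μ/Σ, S, B_n · α)`. -/
noncomputable def fSeqRel {r : ℕ} {X : Type*} (m : MeasurableSpace X) [mX : MeasurableSpace X]
    (μ : Measure X) (T : BorelAction (FG r) X) (a : X → ℕ) (n : ℕ) : ℝ :=
  FFrel m μ T (T.joinF (ball r n) a)

/-- The relative f-invariant entropy `f_G(X, μ/Σ)`, with values in `[-∞, ∞)`. -/
noncomputable def fInvRel {r : ℕ} {X : Type*} (m : MeasurableSpace X) [mX : MeasurableSpace X]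
    (μ : Measure X) (T : BorelAction (FG r) X) (a : X → ℕ) : EReal :=
  ⨅ n : ℕ, ((fSeqRel m μ T a n : ℝ) : EReal)

/-- A total order on `S ∪ S⁻¹` is recorded by an injection `ord : Fin r × Bool → ℕ`;
`g ≺ h` iff `|g| < |h|`, or `|g| = |h|` and the reduced word of `g` lexicographically
precedes that of `h`. -/
def wlt {r : ℕ} (ord : Fin r × Bool → ℕ) (g h : FG r) : Prop :=
  wlen g < wlen h ∨ (wlen g = wlen h ∧ List.Lex (fun p q => ord p < ord q) g.toWord h.toWord)

/-- `Pre(g)`: the set of elements strictly preceding `g`. -/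
def Pre {r : ℕ} (ord : Fin r × Bool → ℕ) (g : FG r) : Set (FG r) := {h | wlt ord h g}

/-- The generator or inverse generator corresponding to a letter. -/
def letter {r : ℕ} (p : Fin r × Bool) : FG r :=
  if p.2 then FreeGroup.of p.1 else (FreeGroup.of p.1)⁻¹

/-- The first (leftmost) letter of the reduced word of `g` (junk value `1` for `g = 1`). -/
def firstLetter {r : ℕ} (g : FG r) : FG r := ((g.toWord.head?).map letter).getD 1

/-- The independence decay `δ(g, α/Σ)`, as a real number:
`δ(g, α/Σ) = H(s⁻¹g·α / Pre(s⁻¹g)·α ∨ Σ) − H(g·α / Pre(g)·α ∨ Σ)` where `s` is the first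
letter of `g`. -/
noncomputable def idecay {r : ℕ} {X I : Type*} (m : MeasurableSpace X) [mX : MeasurableSpace X]
    [Countable I] (μ : Measure X) (T : BorelAction (FG r) X)
    (ord : Fin r × Bool → ℕ) (a : X → I) (g : FG r) : ℝ :=
  (condEntS (m ⊔ T.partSA (Pre ord ((firstLetter g)⁻¹ * g)) a) μ
      (T.tr ((firstLetter g)⁻¹ * g) a)).toReal
  - (condEntS (m ⊔ T.partSA (Pre ord g) a) μ (T.tr g a)).toReal

/-- The entropy `H(τ)` of a probability space: the supremum of the Shannon entropies of
finite measurable partitions. -/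
noncomputable def measEnt {M : Type*} [MeasurableSpace M] (τ : Measure M) : ℝ≥0∞ :=
  ⨆ (P : Finset (Set M)) (_ : ∀ p ∈ P, MeasurableSet p)
    (_ : (P : Set (Set M)).PairwiseDisjoint id) (_ : ⋃₀ (P : Set (Set M)) = Set.univ),
    ∑ p ∈ P, ENNReal.ofReal (Real.negMulLog (τ p).toReal)

/-- The non-negative part of an extended real, in `ℝ≥0∞`. -/
noncomputable def erealToENNReal (x : EReal) : ℝ≥0∞ :=
  if x = ⊤ then ⊤ else ENNReal.ofReal x.toReal

/-- The integral of an `EReal`-valued function (positive part minus negative part),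
with values in `[-∞, ∞]`. -/
noncomputable def eIntegral {M : Type*} [MeasurableSpace M] (τ : Measure M) (f : M → EReal) :
    EReal :=
  ((∫⁻ m, erealToENNReal (f m) ∂τ : ℝ≥0∞) : EReal)
    - ((∫⁻ m, erealToENNReal (-(f m)) ∂τ : ℝ≥0∞) : EReal)

/-- The set of `G`-invariant Borel probability measures on `X`. -/
def InvProb {G X : Type*} [Group G] [MeasurableSpace X] (T : BorelAction G X) :
    Set (Measure X) :=
  {ν | IsProbabilityMeasure ν ∧ ∀ g : G, MeasurePreserving (T.act g) ν ν}

/-- The data of Bowen's example: an ergodic action with defined, finite (indeed zero)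
f-invariant entropy together with a non-trivial subgroup whose restricted action has
infinitely many ergodic components. -/
structure BowenExample (r : ℕ) where
  (X : Type)
  [mX : MeasurableSpace X]
  (sborel : StandardBorelSpace X)
  (μ : Measure X)
  (prob : IsProbabilityMeasure μ)
  (T : BorelAction (FG r) X)
  (pres : T.Preserves μ)
  (erg : T.IsErgodic μ)
  (a : X → ℕ)
  (ameas : Measurable a)
  (agen : T.Generating a μ)
  (aent : Hpart μ a < ⊤)
  (flim : Filter.Tendsto (fun n : ℕ => fSeq μ T a n) Filter.atTop (nhds (0 : ℝ)))
  (Γ : Subgroup (FG r))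
  (Γnt : Γ ≠ ⊥)
  (B : ℕ → Set X)
  (Bmeas : ∀ i, MeasurableSet (B i))
  (Bpos : ∀ i, 0 < μ (B i))
  (Bdisj : Pairwise (Function.onFun Disjoint B))
  (Binv : ∀ i, ∀ γ ∈ Γ, T.smulSet γ (B i) = B i)

open ProbabilityTheory

section Entropy

variable {X I J : Type*} [MeasurableSpace X] [Countable I] [Countable J] {μ : Measure X}

theorem Hpart_comp_of_injective {φ : I → J} (hφ : Function.Injective φ) (a : X → I) :
    Hpart μ (fun x => φ (a x)) = Hpart μ a := by
  have hsupp : Function.support (fun j : J => ENNReal.ofReal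
      (Real.negMulLog (μ ((fun x => φ (a x)) ⁻¹' {j})).toReal)) ⊆ Set.range φ := by
    intro j hj
    by_contra hn
    have : (fun x => φ (a x)) ⁻¹' {j} = ∅ :=
      Set.eq_empty_of_forall_notMem fun x hx => hn ⟨a x, hx⟩
    simp [this] at hj
  rw [Hpart, Hpart, ← hφ.tsum_eq hsupp]
  refine tsum_congr fun i => ?_
  have : (fun x => φ (a x)) ⁻¹' {φ i} = a ⁻¹' {i} := by
    ext x
    simp [hφ.eq_iff]
  rw [this]

theorem Hpart_comp_measurePreserving [MeasurableSpace I] [MeasurableSingletonClass I]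
    {Y : Type*} [MeasurableSpace Y] {ν : Measure Y} {f : X → Y} (hf : MeasurePreserving f μ ν)
    {a : Y → I} (ha : Measurable a) : Hpart μ (fun x => a (f x)) = Hpart ν a := by
  refine tsum_congr fun i => ?_
  rw [← hf.measure_preimage (ha (measurableSet_singleton i)).nullMeasurableSet]
  rfl

theorem tsum_measure_preimage_singleton_eq_one [MeasurableSpace I] [MeasurableSingletonClass I]
    [IsProbabilityMeasure μ] {a : X → I} (ha : Measurable a) : ∑' i, μ (a ⁻¹' {i}) = 1 := by
  rw [← measure_iUnion (fun i j hij => (disjoint_singleton.2 hij).preimage a)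
    (fun i => ha (measurableSet_singleton i)), ← preimage_iUnion, iUnion_of_singleton,
    preimage_univ, measure_univ]

theorem Hpart_prodMk_of_indepFun [MeasurableSpace I] [MeasurableSingletonClass I]
    [MeasurableSpace J] [MeasurableSingletonClass J] [IsProbabilityMeasure μ]
    {a : X → I} {b : X → J} (ha : Measurable a) (hb : Measurable b) (hab : IndepFun a b μ) :
    Hpart μ (fun x => (a x, b x)) = Hpart μ a + Hpart μ b := by
  have key : ∀ i j, ENNReal.ofReal (Real.negMulLog (μ ((fun x => (a x, b x)) ⁻¹' {(i, j)})).toReal)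
      = ENNReal.ofReal (Real.negMulLog (μ (a ⁻¹' {i})).toReal) * μ (b ⁻¹' {j})
        + μ (a ⁻¹' {i}) * ENNReal.ofReal (Real.negMulLog (μ (b ⁻¹' {j})).toReal) := by
    intro i j
    have hset : (fun x => (a x, b x)) ⁻¹' {(i, j)} = a ⁻¹' {i} ∩ b ⁻¹' {j} := by
      ext x
      simp
    have hnn : ∀ s : Set X, 0 ≤ Real.negMulLog (μ s).toReal := fun s =>
      Real.negMulLog_nonneg ENNReal.toReal_nonneg measureReal_le_one
    rw [hset, hab.measure_inter_preimage_eq_mul _ _ (measurableSet_singleton i)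
      (measurableSet_singleton j), ENNReal.toReal_mul, Real.negMulLog_mul, ENNReal.ofReal_add
      (mul_nonneg ENNReal.toReal_nonneg (hnn _)) (mul_nonneg ENNReal.toReal_nonneg (hnn _)),
      ENNReal.ofReal_mul ENNReal.toReal_nonneg, ENNReal.ofReal_mul ENNReal.toReal_nonneg,
      ENNReal.ofReal_toReal (measure_ne_top _ _), ENNReal.ofReal_toReal (measure_ne_top _ _),
      mul_comm (μ (b ⁻¹' {j}))]
  rw [Hpart, ENNReal.tsum_prod']
  simp_rw [key, ENNReal.tsum_add, ENNReal.tsum_mul_left, ENNReal.tsum_mul_right]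
  rw [tsum_measure_preimage_singleton_eq_one ha, tsum_measure_preimage_singleton_eq_one hb,
    mul_one, one_mul]
  rfl

end Entropy

section ProductMeasure

variable {Q : Type*} (p : Measure ℕ) [IsProbabilityMeasure p]

/-- The Bernoulli measure on `Q → ℕ` with base measure `p`. -/
noncomputable abbrev bernoulli (Q : Type*) (p : Measure ℕ) [IsProbabilityMeasure p] :
    Measure (Q → ℕ) :=
  Measure.infinitePi fun _ : Q => p

theorem indepFun_restrict_bernoulli {S T : Finset Q} (hST : Disjoint S T) :
    IndepFun S.restrict T.restrict (bernoulli Q p) :=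
  (iIndepFun_infinitePi (P := fun _ : Q => p) (X := fun _ n => n)
    (fun _ => measurable_id)).indepFun_finset S T hST fun i => measurable_pi_apply i

theorem Hpart_restrict_bernoulli (V : Finset Q) :
    Hpart (bernoulli Q p) V.restrict = V.card * Hpart p id := by
  classical
  induction V using Finset.induction_on with
  | empty =>
    have h (y : (∅ : Finset Q) → ℕ) :
        (∅ : Finset Q).restrict (π := fun _ => ℕ) ⁻¹' {y} = Set.univ :=
      Set.eq_univ_of_forall fun x => Subsingleton.elim _ _
    simp [Hpart, h]
  | insert v V hv ih =>
    have hinj : Function.Injective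
        (fun y : ↥(insert v V) → ℕ =>
          (Finset.restrict₂ (π := fun _ => ℕ) (Finset.singleton_subset_iff.2
              (Finset.mem_insert_self v V)) y,
            Finset.restrict₂ (π := fun _ => ℕ) (Finset.subset_insert v V) y)) := by
      intro y z hyz
      simp only [Prod.mk.injEq] at hyz
      funext ⟨q, hq⟩
      rcases Finset.mem_insert.1 hq with rfl | hq'
      · exact congrFun hyz.1 ⟨q, Finset.mem_singleton_self q⟩
      · exact congrFun hyz.2 ⟨q, hq'⟩
    have hone : Hpart (bernoulli Q p) (Finset.restrict (π := fun _ => ℕ) {v}) = Hpart p id := by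
      have hev : Function.Injective (fun (y : ↥({v} : Finset Q) → ℕ) =>
          y ⟨v, Finset.mem_singleton_self v⟩) := by
        intro y z hyz
        funext ⟨q, hq⟩
        obtain rfl := Finset.mem_singleton.1 hq
        exact hyz
      rw [← Hpart_comp_of_injective hev]
      exact Hpart_comp_measurePreserving (measurePreserving_eval_infinitePi (fun _ : Q => p) v)
        measurable_id
    rw [← Hpart_comp_of_injective hinj]
    refine (Hpart_prodMk_of_indepFun (Finset.measurable_restrict _) (Finset.measurable_restrict _)
      (indepFun_restrict_bernoulli p (Finset.disjoint_singleton_left.2 hv))).trans ?_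
    rw [hone, ih, Finset.card_insert_of_notMem hv]
    push_cast
    ring

theorem Hpart_bernoulli_comp {F : Type*} [Finite F] (c : F → Q) :
    Hpart (bernoulli Q p) (fun x f => x (c f)) = (Set.range c).ncard * Hpart p id := by
  have hfin := Set.finite_range c
  have hinj : Function.Injective (fun (y : hfin.toFinset → ℕ) (f : F) =>
      y ⟨c f, hfin.mem_toFinset.2 ⟨f, rfl⟩⟩) := by
    intro y z hyz
    funext ⟨q, hq⟩
    obtain ⟨f, rfl⟩ := hfin.mem_toFinset.1 hq
    exact congrFun hyz f
  rw [Set.ncard_eq_toFinset_card _ hfin, ← Hpart_restrict_bernoulli,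
    ← Hpart_comp_of_injective hinj]
  rfl

theorem Hpart_bernoulli_comp_prodMk {F : Type*} [Finite F] (c d : F → Q) :
    Hpart (bernoulli Q p) (fun x => ((fun f => x (c f), fun f => x (d f)) : (F → ℕ) × (F → ℕ)))
      = (Set.range c ∪ Set.range d).ncard * Hpart p id := by
  rw [← Set.Sum.elim_range, ← Hpart_bernoulli_comp,
    ← Hpart_comp_of_injective (Equiv.sumArrowEquivProdArrow F F ℕ).injective]
  rfl

end ProductMeasure

section Action

variable {G Q : Type*} [Group G] [MulAction G Q]

/-- The generalized shift of `G` on `Q → ℕ` induced by an action of `G` on `Q`. -/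
def shift (G Q : Type*) [Group G] [MulAction G Q] : BorelAction G (Q → ℕ) where
  act g x q := x (g⁻¹ • q)
  act_one x := by simp
  act_mul g h x := by simp [mul_smul]
  measurable_act g := measurable_pi_lambda _ fun q => measurable_pi_apply _

theorem shift_act_apply (g : G) (x : Q → ℕ) (q : Q) : (shift G Q).act g x q = x (g⁻¹ • q) := rfl

variable (p : Measure ℕ) [IsProbabilityMeasure p]

theorem shift_preserves : (shift G Q).Preserves (bernoulli Q p) := fun g =>
  ⟨(shift G Q).measurable_act g,
    Measure.map_infinitePi_infinitePi_of_inj (MulAction.injective g⁻¹)⟩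

theorem shift_isErgodic
    (hdisj : ∀ V : Finset Q, ∃ g : G, ∀ u ∈ V, g • u ∉ V) :
    (shift G Q).IsErgodic (bernoulli Q p) := by
  classical
  intro B hB hinv
  set μ := bernoulli Q p
  have hsq : ∀ ε : ℝ, 0 < ε → |μ.real B - μ.real B * μ.real B| ≤ 4 * ε := by
    intro ε hε
    obtain ⟨C, hC, hBC⟩ := (Measure.MeasureDense.of_generateFrom_isSetAlgebra_finite μ
      isSetAlgebra_measurableCylinders generateFrom_measurableCylinders.symm).approx B hB
      (measure_ne_top _ _) ε hε
    obtain ⟨V, S, hS, rfl⟩ := (mem_measurableCylinders C).1 hC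
    obtain ⟨g, hg⟩ := hdisj V
    set C := cylinder (α := fun _ : Q => ℕ) V S
    have hCm : MeasurableSet C := hS.cylinder
    have hmp : MeasurePreserving ((shift G Q).act g⁻¹) μ μ := shift_preserves p g⁻¹
    set C' := (shift G Q).smulSet g C with hC'
    have hC'm : MeasurableSet C' := hmp.measurable hCm
    have hμC' : μ C' = μ C := hmp.measure_preimage hCm.nullMeasurableSet
    have hind : μ (C ∩ C') = μ C * μ C := by
      have hd : Disjoint V (V.image (g • ·)) := by
        rw [Finset.disjoint_right]
        intro q hq
        obtain ⟨u, hu, rfl⟩ := Finset.mem_image.1 hq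
        exact hg u hu
      let ψ : (V.image (g • ·) → ℕ) → (V → ℕ) :=
        fun y v => y ⟨g • v.1, Finset.mem_image_of_mem _ v.2⟩
      have hψ : Measurable ψ := measurable_pi_lambda _ fun v => measurable_pi_apply _
      have hC'eq : C' = (V.image (g • ·)).restrict ⁻¹' (ψ ⁻¹' S) := by
        ext x
        have : V.restrict ((shift G Q).act g⁻¹ x) = ψ ((V.image (g • ·)).restrict x) := by
          funext v
          simp [shift_act_apply, ψ]
        simp [hC', BorelAction.smulSet, C, this]
      have := (indepFun_restrict_bernoulli p hd).measure_inter_preimage_eq_mul S (ψ ⁻¹' S) hS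
        (hψ hS)
      rw [← hC'eq] at this
      exact this.trans (by rw [hμC']; rfl)
    have h1 : μ.real (B ∆ C) ≤ ε := ENNReal.toReal_le_of_le_ofReal hε.le hBC.le
    have h2 : μ.real (B ∆ C') ≤ ε := by
      have hle := measureReal_symmDiff_le (μ := μ) (s := B)
        (t := (shift G Q).smulSet g B) C'
      have h0 : μ.real (B ∆ (shift G Q).smulSet g B) = 0 := by
        rw [symmDiff_comm, measureReal_def, hinv g, ENNReal.toReal_zero]
      have he : μ.real ((shift G Q).smulSet g B ∆ C') = μ.real (B ∆ C) :=
        congrArg ENNReal.toReal (hmp.measure_preimage (hB.symmDiff hCm).nullMeasurableSet)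
      linarith
    have h3 : μ.real (B ∆ (C ∩ C')) ≤ 2 * ε := by
      have hsub : B ∆ (C ∩ C') ⊆ B ∆ C ∪ B ∆ C' := by
        intro x
        simp only [Set.mem_symmDiff, Set.mem_union, Set.mem_inter_iff]
        tauto
      have := (measureReal_mono (μ := μ) hsub).trans (measureReal_union_le _ _)
      linarith
    have h4 := (abs_measureReal_sub_le_measureReal_symmDiff (μ := μ) hB.nullMeasurableSet
      hCm.nullMeasurableSet).trans h1
    have h5 := (abs_measureReal_sub_le_measureReal_symmDiff (μ := μ) hB.nullMeasurableSet
      (hCm.inter hC'm).nullMeasurableSet).trans h3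
    have h6 : μ.real (C ∩ C') = μ.real C * μ.real C := by
      simp only [measureReal_def, hind, ENNReal.toReal_mul]
    rw [h6] at h5
    have hB1 : μ.real B ≤ 1 := measureReal_le_one
    have hC1 : μ.real C ≤ 1 := measureReal_le_one
    have hB0 : 0 ≤ μ.real B := measureReal_nonneg
    have hC0 : 0 ≤ μ.real C := measureReal_nonneg
    rw [abs_le] at h4 h5 ⊢
    constructor <;> nlinarith
  have h0 : |μ.real B - μ.real B * μ.real B| ≤ 0 :=
    le_of_forall_pos_le_add fun ε hε => by
      have := hsq (ε / 4) (by positivity)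
      linarith
  have h1 : μ.real B * (1 - μ.real B) = 0 := by
    have := abs_nonpos_iff.1 h0
    linarith
  rcases mul_eq_zero.1 h1 with h | h
  · exact Or.inl ((measureReal_eq_zero_iff).1 h)
  · refine Or.inr ?_
    rw [← ENNReal.ofReal_toReal (measure_ne_top μ B), ← measureReal_def,
      show μ.real B = 1 by linarith, ENNReal.ofReal_one]

theorem shift_generating {q₀ : Q} (htrans : ∀ q : Q, ∃ g : G, g • q₀ = q)
    (ν : Measure (Q → ℕ)) : (shift G Q).Generating (fun x => x q₀) ν := by
  intro B hB
  refine ⟨B, ?_, by simp⟩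
  have hle : (MeasurableSpace.pi : MeasurableSpace (Q → ℕ)) ≤
      (shift G Q).partSA Set.univ (fun x => x q₀) := by
    refine iSup_le fun q => ?_
    obtain ⟨g, rfl⟩ := htrans q
    refine le_trans (le_of_eq ?_) (le_iSup₂ g (Set.mem_univ g))
    congr 1
    funext x
    exact congrArg (fun h : G => x (h • q₀)) (inv_inv g).symm
  exact hle B hB

end Action

section Combinatorics

open FreeGroup

variable {r : ℕ}

theorem toWord_letter_mul {i : Fin r} {b : Bool} {g : FG r}
    (h : g.toWord.head? ≠ some (i, !b)) :
    (FreeGroup.mk [(i, b)] * g).toWord = (i, b) :: g.toWord := by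
  rw [toWord_mul, toWord_mk, reduce_singleton, List.singleton_append, reduce.cons, reduce_toWord]
  cases hw : g.toWord with
  | nil => rfl
  | cons c l =>
    have : ¬ (i = c.1 ∧ b = !c.2) := by
      rintro ⟨h1, h2⟩
      apply h
      rw [hw, List.head?_cons, h1, h2, Bool.not_not]
    simp [this]

theorem toWord_eq_cons {i : Fin r} {b : Bool} {g : FG r} (h : g.toWord.head? = some (i, b)) :
    g.toWord = (i, b) :: (FreeGroup.mk [(i, !b)] * g).toWord := by
  rw [toWord_mul, toWord_mk, reduce_singleton, List.singleton_append, reduce.cons, reduce_toWord]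
  cases hw : g.toWord with
  | nil => simp [hw] at h
  | cons c l =>
    rw [hw, List.head?_cons, Option.some_inj] at h
    simp [h]

theorem of_eq_mk (i : Fin r) : of i = FreeGroup.mk [(i, true)] := rfl

theorem of_inv_eq_mk (i : Fin r) : (of i)⁻¹ = FreeGroup.mk [(i, false)] := rfl

/-- Elements whose reduced word does not end in a power of the generator `i₀`. -/
def NoTail (i₀ : Fin r) (g : FG r) : Prop := ∀ c ∈ g.toWord.getLast?, c.1 ≠ i₀

theorem noTail_of_toWord_eq_cons {i₀ : Fin r} {g h : FG r} {c : Fin r × Bool}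
    (hgh : g.toWord = c :: h.toWord) (hg : NoTail i₀ g) : NoTail i₀ h := by
  intro d hd
  refine hg d ?_
  rw [hgh]
  cases hw : h.toWord with
  | nil => simp [hw] at hd
  | cons e l =>
    rw [hw] at hd
    rwa [List.getLast?_cons_cons]

theorem noTail_of_toWord_cons_eq {i₀ : Fin r} {g h : FG r} {c : Fin r × Bool}
    (hgh : h.toWord = c :: g.toWord) (hg : NoTail i₀ g) (hc : g = 1 → c.1 ≠ i₀) :
    NoTail i₀ h := by
  intro d hd
  rw [hgh] at hd
  cases hw : g.toWord with
  | nil =>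
    rw [hw] at hd
    obtain rfl : c = d := by simpa using hd
    exact hc (toWord_eq_nil_iff.1 hw)
  | cons e l =>
    rw [hw, List.getLast?_cons_cons, ← hw] at hd
    exact hg d hd

theorem noTail_inv_of_mul {i₀ i : Fin r} {g : FG r} (hg : NoTail i₀ g)
    (hne : ¬ (i = i₀ ∧ g = 1)) : NoTail i₀ ((of i)⁻¹ * g) := by
  by_cases h : g.toWord.head? = some (i, true)
  · exact noTail_of_toWord_eq_cons (toWord_eq_cons h) hg
  · exact noTail_of_toWord_cons_eq (toWord_letter_mul (b := false) h) hg
      fun h1 hi => hne ⟨hi, h1⟩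

/-- The coset space of the cyclic subgroup generated by the generator `i₀`. -/
abbrev GenCoset (i₀ : Fin r) := FG r ⧸ Subgroup.zpowers (of i₀)

theorem exists_noTail (i₀ : Fin r) (g : FG r) :
    ∃ h, NoTail i₀ h ∧ wlen h ≤ wlen g ∧ (h : GenCoset i₀) = g := by
  induction hn : wlen g using Nat.strong_induction_on generalizing g with
  | _ n ih =>
    subst hn
    by_cases hg : NoTail i₀ g
    · exact ⟨g, hg, le_rfl, rfl⟩
    · simp only [NoTail, not_forall, not_not] at hg
      obtain ⟨⟨i, b⟩, hc, rfl⟩ := hg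
      obtain ⟨l, hl⟩ := List.getLast?_eq_some_iff.1 hc
      have hlen : wlen (FreeGroup.mk l : FG r) < wlen g := by
        have h1 : wlen (FreeGroup.mk l : FG r) ≤ l.length := norm_mk_le
        have h2 : wlen g = l.length + 1 := by rw [wlen, hl]; simp
        omega
      obtain ⟨h, hh, hle, heq⟩ := ih _ hlen _ rfl
      refine ⟨h, hh, hle.trans hlen.le, heq.trans ?_⟩
      have hg : g = FreeGroup.mk l * FreeGroup.mk [(i, b)] := by
        rw [mul_mk, ← hl, mk_toWord]
      rw [QuotientGroup.eq, hg, inv_mul_cancel_left]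
      cases b
      · exact inv_mem (Subgroup.mem_zpowers (of i))
      · exact Subgroup.mem_zpowers (of i)

theorem pow_eq_zero_of_noTail_mul {i₀ : Fin r} {g : FG r} {k : ℕ} (hg : NoTail i₀ g)
    (hk : NoTail i₀ (g * of i₀ ^ k)) : k = 0 := by
  by_contra hk0
  have hred : IsReduced (g.toWord ++ List.replicate k (i₀, true)) := by
    refine List.isChain_append.2 ⟨isReduced_toWord, ?_, ?_⟩
    · have := isReduced_toWord (x := (of i₀ ^ k : FG r))
      rwa [toWord_of_pow] at this
    · intro c hc d hd hcd
      have : d = (i₀, true) := List.eq_of_mem_replicate (List.mem_of_mem_head? hd)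
      exact absurd (hcd.trans (by rw [this])) (hg c hc)
  refine hk (i₀, true) ?_ rfl
  rw [toWord_mul, toWord_of_pow, hred.reduce_eq, List.getLast?_append]
  simp [List.getLast?_replicate, hk0]

theorem noTail_injOn (i₀ : Fin r) {g h : FG r} (hg : NoTail i₀ g) (hh : NoTail i₀ h)
    (hgh : (g : GenCoset i₀) = h) : g = h := by
  obtain ⟨k, hk⟩ := Subgroup.mem_zpowers_iff.1 (QuotientGroup.eq.1 hgh)
  have hk' : h = g * of i₀ ^ k := by rw [hk, mul_inv_cancel_left]
  rcases Int.eq_nat_or_neg k with ⟨m, rfl | rfl⟩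
  · rw [zpow_natCast] at hk'
    have := pow_eq_zero_of_noTail_mul hg (hk' ▸ hh)
    simpa [this] using hk'.symm
  · have hk'' : g = h * of i₀ ^ m := by simp [hk']
    have := pow_eq_zero_of_noTail_mul hh (hk'' ▸ hg)
    simpa [this] using hk''

/-- The edge of the Schreier graph of `GenCoset i₀` leaving the vertex represented by `g` towards
the base point; the base point itself is sent to its loop. -/
def parentEdge (i₀ : Fin r) (g : FG r) : Fin r × FG r :=
  match g.toWord.head? with
  | none => (i₀, 1)
  | some (i, true) => (i, g)
  | some (i, false) => (i, of i * g)

theorem parentEdge_of_head?_true {i₀ i : Fin r} {g : FG r}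
    (h : g.toWord.head? = some (i, true)) : parentEdge i₀ g = (i, g) := by
  simp [parentEdge, h]

theorem parentEdge_of_head?_false {i₀ i : Fin r} {g : FG r}
    (h : g.toWord.head? = some (i, false)) : parentEdge i₀ g = (i, of i * g) := by
  simp [parentEdge, h]

theorem eq_one_or_head? (g : FG r) :
    g = 1 ∨ ∃ i, g.toWord.head? = some (i, true) ∨ g.toWord.head? = some (i, false) := by
  rcases h : g.toWord.head? with _ | ⟨i, _ | _⟩
  · exact Or.inl (toWord_eq_nil_iff.1 (List.head?_eq_none_iff.1 h))
  · exact Or.inr ⟨i, Or.inr rfl⟩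
  · exact Or.inr ⟨i, Or.inl rfl⟩

theorem head?_of_mul_ne {i : Fin r} {g : FG r} (h : g.toWord.head? = some (i, false)) :
    (of i * g).toWord.head? ≠ some (i, true) := by
  intro h'
  have h1 := congrArg List.length (toWord_eq_cons h)
  have h2 := congrArg List.length (toWord_eq_cons h')
  simp only [Bool.not_true, Bool.not_false, ← of_eq_mk, ← of_inv_eq_mk, inv_mul_cancel_left,
    List.length_cons] at h1 h2
  omega

theorem parentEdge_injOn (i₀ : Fin r) {g h : FG r} (hg : NoTail i₀ g) (hh : NoTail i₀ h)
    (heq : parentEdge i₀ g = parentEdge i₀ h) : g = h := by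
  have hone : ∀ {g : FG r}, NoTail i₀ g → parentEdge i₀ g = (i₀, 1) → g = 1 := by
    intro g hg he
    rcases eq_one_or_head? g with h1 | ⟨i, hi | hi⟩
    · exact h1
    · rw [parentEdge_of_head?_true hi] at he
      exact congrArg Prod.snd he
    · rw [parentEdge_of_head?_false hi, Prod.mk.injEq] at he
      have hw := toWord_eq_cons hi
      rw [Bool.not_false, ← of_eq_mk, he.2, toWord_one] at hw
      exact absurd he.1 (hg (i, false) (by simp [hw]))
  have hmix : ∀ {g h : FG r} {i j : Fin r}, g.toWord.head? = some (i, true) →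
      h.toWord.head? = some (j, false) → parentEdge i₀ g ≠ parentEdge i₀ h := by
    intro g h i j hi hj he
    rw [parentEdge_of_head?_true hi, parentEdge_of_head?_false hj, Prod.mk.injEq] at he
    obtain ⟨rfl, rfl⟩ := he
    exact head?_of_mul_ne hj hi
  rcases eq_one_or_head? g with rfl | ⟨i, hi | hi⟩
  · exact (hone hh heq.symm).symm
  · rcases eq_one_or_head? h with rfl | ⟨j, hj | hj⟩
    · exact hone hg heq
    · rw [parentEdge_of_head?_true hi, parentEdge_of_head?_true hj] at heq
      exact congrArg Prod.snd heq
    · exact absurd heq (hmix hi hj)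
  · rcases eq_one_or_head? h with rfl | ⟨j, hj | hj⟩
    · exact hone hg heq
    · exact absurd heq.symm (hmix hj hi)
    · rw [parentEdge_of_head?_false hi, parentEdge_of_head?_false hj, Prod.mk.injEq] at heq
      obtain ⟨rfl, h2⟩ := heq
      exact mul_left_cancel h2

/-- The set of representatives of the cosets meeting the ball of radius `n`. -/
def repBall (i₀ : Fin r) (n : ℕ) : Set (FG r) := {g | NoTail i₀ g ∧ g ∈ ball r n}

theorem repBall_finite (i₀ : Fin r) (n : ℕ) : (repBall i₀ n).Finite :=
  (Set.toFinite (ball r n)).subset fun _ hg => hg.2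

theorem image_repBall (i₀ : Fin r) (n : ℕ) :
    (fun g : FG r => (g : GenCoset i₀)) '' repBall i₀ n =
      (fun g : FG r => (g : GenCoset i₀)) '' ball r n := by
  refine Set.Subset.antisymm (Set.image_mono fun _ hg => hg.2) ?_
  rintro _ ⟨g, hg, rfl⟩
  obtain ⟨h, hh, hle, heq⟩ := exists_noTail i₀ g
  exact ⟨h, ⟨hh, le_trans hle hg⟩, heq⟩

/-- The edges of type `i` between cosets meeting the ball of radius `n`, recorded by the
representative of their target. -/
def repEdges (i₀ : Fin r) (n : ℕ) (i : Fin r) : Set (FG r) :=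
  {g ∈ repBall i₀ n | (of i)⁻¹ * g ∈ repBall i₀ n ∨ (i = i₀ ∧ g = 1)}

theorem image_repEdges (i₀ : Fin r) (n : ℕ) (i : Fin r) :
    (fun g : FG r => (g : GenCoset i₀)) '' repEdges i₀ n i =
      (of i • (fun g : FG r => (g : GenCoset i₀)) '' ball r n) ∩
        (fun g : FG r => (g : GenCoset i₀)) '' ball r n := by
  rw [← image_repBall]
  ext q
  simp only [Set.mem_inter_iff, Set.mem_smul_set_iff_inv_smul_mem]
  constructor
  · rintro ⟨g, ⟨hg, hg' | ⟨rfl, rfl⟩⟩, rfl⟩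
    · exact ⟨⟨_, hg', rfl⟩, ⟨g, hg, rfl⟩⟩
    · refine ⟨⟨1, hg, ?_⟩, ⟨1, hg, rfl⟩⟩
      refine QuotientGroup.eq.2 ?_
      simp
  · rintro ⟨⟨h, hh, heq⟩, ⟨g, hg, rfl⟩⟩
    refine ⟨g, ⟨hg, ?_⟩, rfl⟩
    by_cases hne : i = i₀ ∧ g = 1
    · exact Or.inr hne
    · left
      have := noTail_injOn i₀ hh.1 (noTail_inv_of_mul hg.1 hne) heq
      rwa [← this]

theorem sum_ncard_repEdges (i₀ : Fin r) (n : ℕ) :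
    ∑ i, (repEdges i₀ n i).ncard = (repBall i₀ n).ncard := by
  classical
  have hfin : ∀ i, (repEdges i₀ n i).Finite := fun i => (repBall_finite i₀ n).subset fun _ h => h.1
  have hcons : ∀ {g h : FG r} {c : Fin r × Bool}, g.toWord = c :: h.toWord → g ∈ repBall i₀ n →
      h ∈ repBall i₀ n := by
    intro g h c hgh hg
    refine ⟨noTail_of_toWord_eq_cons hgh hg.1, ?_⟩
    have h1 : wlen g = wlen h + 1 := by rw [wlen, hgh]; rfl
    have h2 : wlen g ≤ n := hg.2
    change wlen h ≤ n
    omega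
  have hcard : ∑ i, (hfin i).toFinset.card = (repBall_finite i₀ n).toFinset.card := by
    rw [← Finset.card_sigma]
    symm
    refine Finset.card_bij (fun g _ => ⟨(parentEdge i₀ g).1, (parentEdge i₀ g).2⟩) ?_ ?_ ?_
    · intro g hg
      rw [Set.Finite.mem_toFinset] at hg
      simp only [Finset.mem_sigma, Finset.mem_univ, true_and, Set.Finite.mem_toFinset]
      rcases eq_one_or_head? g with rfl | ⟨i, hi | hi⟩
      · exact ⟨hg, Or.inr ⟨rfl, rfl⟩⟩
      · rw [parentEdge_of_head?_true hi]
        exact ⟨hg, Or.inl (hcons (toWord_eq_cons hi) hg)⟩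
      · rw [parentEdge_of_head?_false hi]
        refine ⟨hcons (toWord_eq_cons hi) hg, Or.inl ?_⟩
        rwa [inv_mul_cancel_left]
    · intro g hg h hh heq
      rw [Set.Finite.mem_toFinset] at hg hh
      simp only [Sigma.mk.injEq, heq_eq_eq] at heq
      exact parentEdge_injOn i₀ hg.1 hh.1 (Prod.ext heq.1 heq.2)
    · rintro ⟨i, g⟩ hig
      simp only [Finset.mem_sigma, Finset.mem_univ, true_and, Set.Finite.mem_toFinset] at hig
      by_cases hi : g.toWord.head? = some (i, true)
      · exact ⟨g, (Set.Finite.mem_toFinset _).2 hig.1, by rw [parentEdge_of_head?_true hi]⟩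
      · rcases hig.2 with hmem | ⟨rfl, rfl⟩
        · refine ⟨_, (Set.Finite.mem_toFinset _).2 hmem, ?_⟩
          have hw : ((of i)⁻¹ * g).toWord = (i, false) :: g.toWord :=
            toWord_letter_mul (b := false) hi
          rw [parentEdge_of_head?_false (i := i) (by rw [hw]; rfl), mul_inv_cancel_left]
        · exact ⟨1, (Set.Finite.mem_toFinset _).2 hig.1, rfl⟩
  rw [Set.ncard_eq_toFinset_card _ (repBall_finite i₀ n), ← hcard]
  exact Finset.sum_congr rfl fun i _ => Set.ncard_eq_toFinset_card _ (hfin i)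

/-- The cosets meeting the ball of radius `n` span a subgraph of the Schreier graph with exactly
as many edges as vertices. -/
theorem sum_ncard_smul_union (i₀ : Fin r) (n : ℕ) (V : Set (GenCoset i₀))
    (hV : V = (fun g : FG r => (g : GenCoset i₀)) '' ball r n) :
    ∑ i : Fin r, (of i • V ∪ V).ncard + V.ncard = 2 * r * V.ncard := by
  have hVfin : V.Finite := hV ▸ (Set.toFinite (ball r n)).image _
  have hinj : Set.InjOn (fun g : FG r => (g : GenCoset i₀)) (repBall i₀ n) :=
    fun g hg h hh heq => noTail_injOn i₀ hg.1 hh.1 heq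
  have hedges : ∑ i : Fin r, (of i • V ∩ V).ncard = V.ncard := by
    rw [hV, ← image_repBall, hinj.ncard_image, ← sum_ncard_repEdges, image_repBall]
    refine Finset.sum_congr rfl fun i _ => ?_
    rw [← image_repEdges, (hinj.mono fun _ h => h.1).ncard_image]
  have hsum : ∀ i : Fin r, (of i • V ∪ V).ncard + (of i • V ∩ V).ncard = 2 * V.ncard := by
    intro i
    rw [Set.ncard_union_add_ncard_inter _ _ (hVfin.smul_set) hVfin, Set.ncard_smul_set, two_mul]
  calc ∑ i : Fin r, (of i • V ∪ V).ncard + V.ncard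
      = ∑ i : Fin r, ((of i • V ∪ V).ncard + (of i • V ∩ V).ncard) := by
        rw [Finset.sum_add_distrib, hedges]
    _ = 2 * r * V.ncard := by
        simp only [hsum, Finset.sum_const, Finset.card_univ, Fintype.card_fin, smul_eq_mul]
        ring

theorem exists_smul_notMem {i₀ i₁ : Fin r} (hi : i₁ ≠ i₀) (V : Finset (GenCoset i₀)) :
    ∃ g : FG r, ∀ u ∈ V, g • u ∉ V := by
  by_contra! hcon
  choose u hu hgu using fun N : ℕ => hcon (of i₁ ^ N)
  obtain ⟨M, N, hMN, heq⟩ := Finite.exists_ne_map_eq_of_infinite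
    (fun N : ℕ => ((⟨u N, hu N⟩, ⟨_, hgu N⟩) : V × V))
  simp only [Prod.mk.injEq, Subtype.mk.injEq] at heq
  obtain ⟨h1, h2⟩ := heq
  rw [← h1] at h2
  obtain ⟨h, hh⟩ := QuotientGroup.mk_surjective (u M)
  rw [← hh] at h2
  have h3 := QuotientGroup.eq.1 h2
  obtain ⟨k, hk⟩ := Subgroup.mem_zpowers_iff.1 h3
  let φ : FG r →* Multiplicative ℤ :=
    FreeGroup.lift fun i => if i = i₁ then Multiplicative.ofAdd 1 else 1
  have h4 := congrArg (fun g => (φ g).toAdd) hk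
  simp [φ, hi.symm] at h4
  omega

end Combinatorics

section GeometricMeasure

/-- The geometric distribution on `ℕ` with parameter `1 / 2`. -/
noncomputable def geometric : Measure ℕ :=
  Measure.sum fun k : ℕ => ((2 : ℝ≥0∞)⁻¹ ^ (k + 1)) • Measure.dirac k

theorem geometric_singleton (k : ℕ) : geometric {k} = (2 : ℝ≥0∞)⁻¹ ^ (k + 1) := by
  rw [geometric, Measure.sum_apply _ (measurableSet_singleton k), tsum_eq_single k]
  · simp
  · intro j hj
    simp [hj]

instance : IsProbabilityMeasure geometric := by
  constructor
  rw [geometric, Measure.sum_apply _ MeasurableSet.univ]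
  simp only [Measure.smul_apply, measure_univ, smul_eq_mul, mul_one]
  rw [ENNReal.tsum_geometric_add_one, ENNReal.one_sub_inv_two, inv_inv,
    ENNReal.inv_mul_cancel two_ne_zero ENNReal.ofNat_ne_top]

theorem Hpart_geometric_lt_top : Hpart geometric id < ⊤ := by
  have hterm : ∀ k : ℕ, Real.negMulLog (geometric (id ⁻¹' {k})).toReal
      = ((k + 1 : ℕ) : ℝ) ^ 1 * (2⁻¹ : ℝ) ^ (k + 1) * Real.log 2 := by
    intro k
    rw [preimage_id, geometric_singleton, ENNReal.toReal_pow, ENNReal.toReal_inv,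
      ENNReal.toReal_ofNat, Real.negMulLog, Real.log_pow, Real.log_inv]
    ring
  have hsum : Summable fun k : ℕ => Real.negMulLog (geometric (id ⁻¹' {k})).toReal := by
    simp_rw [hterm]
    refine Summable.mul_right _ ?_
    exact (summable_nat_add_iff 1).2
      (summable_pow_mul_geometric_of_norm_lt_one 1 (r := (2⁻¹ : ℝ)) (by norm_num))
  exact hsum.tsum_ofReal_lt_top

end GeometricMeasure

section Example

variable {r : ℕ}

theorem fSeq_shift_genCoset (i₀ : Fin r) (p : Measure ℕ) [IsProbabilityMeasure p] (n : ℕ) :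
    fSeq (bernoulli (GenCoset i₀) p) (shift (FG r) (GenCoset i₀))
      (fun x => x ((1 : FG r) : GenCoset i₀)) n = 0 := by
  set V : Set (GenCoset i₀) := (fun g : FG r => (g : GenCoset i₀)) '' ball r n with hV
  have hrange : Set.range (fun f : ball r n => ((f : FG r) : GenCoset i₀)) = V := by
    rw [hV, Set.image_eq_range]
  have hjoin : (shift (FG r) (GenCoset i₀)).joinF (ball r n)
      (fun x => x ((1 : FG r) : GenCoset i₀)) = fun x f => x ((f : FG r) : GenCoset i₀) := by
    funext x f
    simp [BorelAction.joinF, shift_act_apply]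
  have hpair : ∀ i : Fin r, Hpart (bernoulli (GenCoset i₀) p)
      (fun x => ((shift (FG r) (GenCoset i₀)).tr (FreeGroup.of i)
        (fun x (f : ball r n) => x ((f : FG r) : GenCoset i₀)) x,
        fun f : ball r n => x ((f : FG r) : GenCoset i₀)))
      = (FreeGroup.of i • V ∪ V).ncard * Hpart p id := by
    intro i
    have hsmul : Set.range (fun f : ball r n => FreeGroup.of i • ((f : FG r) : GenCoset i₀))
        = FreeGroup.of i • V := by
      rw [← hrange, ← Set.image_smul, ← Set.range_comp]
      rfl
    rw [← hsmul, ← hrange, ← Hpart_bernoulli_comp_prodMk]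
    congr 1
  have hcount := congrArg (Nat.cast (R := ℝ)) (sum_ncard_smul_union i₀ n V hV)
  push_cast at hcount
  rw [fSeq, hjoin, FF]
  simp_rw [hpair]
  rw [Hpart_bernoulli_comp, hrange]
  simp only [ENNReal.toReal_mul, ENNReal.toReal_natCast]
  rw [← Finset.sum_mul, eq_sub_of_add_eq hcount]
  ring

end Example

/-- For every free group of rank `r > 1` such an example exists. -/
theorem statement19 (r : ℕ) (hr : 1 < r) : Nonempty (BowenExample r) := by
  let i₀ : Fin r := ⟨0, by omega⟩
  let q₀ : GenCoset i₀ := ((1 : FG r) : GenCoset i₀)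
  have hi : (⟨1, hr⟩ : Fin r) ≠ i₀ := by simp [i₀]
  have hcount : Countable (FG r) := FreeGroup.toWord_injective.countable
  have hcount' : Countable (GenCoset i₀) := QuotientGroup.mk_surjective.countable
  have heval := measurePreserving_eval_infinitePi (fun _ : GenCoset i₀ => geometric) q₀
  exact ⟨{
    X := GenCoset i₀ → ℕ
    sborel := inferInstance
    μ := bernoulli (GenCoset i₀) geometric
    prob := inferInstance
    T := shift (FG r) (GenCoset i₀)
    pres := shift_preserves geometric
    erg := shift_isErgodic geometric (exists_smul_notMem hi)
    a := fun x => x q₀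
    ameas := measurable_pi_apply q₀
    agen := by
      refine shift_generating (fun q => ?_) _
      obtain ⟨g, rfl⟩ := QuotientGroup.mk_surjective q
      exact ⟨g, by simp [q₀]⟩
    aent := by
      refine lt_of_eq_of_lt ?_ Hpart_geometric_lt_top
      exact Hpart_comp_measurePreserving heval measurable_id
    flim := by
      simp only [q₀, fSeq_shift_genCoset]
      exact tendsto_const_nhds
    Γ := Subgroup.zpowers (FreeGroup.of i₀)
    Γnt := by simp
    B := fun k => (fun x => x q₀) ⁻¹' {k}
    Bmeas := fun k => measurable_pi_apply q₀ (measurableSet_singleton k)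
    Bpos := fun k => by
      have h := heval.measure_preimage (measurableSet_singleton k).nullMeasurableSet
      rw [geometric_singleton] at h
      exact lt_of_lt_of_eq (ENNReal.pow_pos (by simp) _) h.symm
    Bdisj := fun j k hjk => Set.disjoint_left.2 fun x hj hk => hjk (hj.symm.trans hk)
    Binv := fun k γ hγ => by
      ext x
      have hfix : γ • q₀ = q₀ := by
        refine (QuotientGroup.eq.2 ?_).symm
        simpa using hγ
      simp [BorelAction.smulSet, shift_act_apply, hfix] }⟩

end FPaper
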